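/- arXiv:2207.08469 — 2 statements merged into one kernel-verified Lean document; each statement's English description precedes it below -/
import Mathlib

section
/- Let Y be binomially distributed with parameters N and p ∈ (0,1), and let X have the law of Y conditioned on Y ≤ N-1. Then E[X] = N(p - p^N)/(1 - p^N) and Var(X) = N·p(1-p)/(1 - p^N) - N^2·p^N(1-p)^2/(1 - p^N)^2. -/
theorem stmt_6 (N : ℕ) (hN : 1 ≤ N) (p : ℝ) (hp : p ∈ Set.Ioo (0 : ℝ) 1)
    (q : ℕ → ℝ)
    (hq : ∀ k, q k = (N.choose k : ℝ) * p ^ k * (1 - p) ^ (N - k) / (1 - p ^ N)) :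
    (∑ k ∈ Finset.range N, (k : ℝ) * q k) = N * (p - p ^ N) / (1 - p ^ N) ∧
    (∑ k ∈ Finset.range N, (k : ℝ) ^ 2 * q k) - (∑ k ∈ Finset.range N, (k : ℝ) * q k) ^ 2
      = N * p * (1 - p) / (1 - p ^ N)
        - (N : ℝ) ^ 2 * p ^ N * (1 - p) ^ 2 / (1 - p ^ N) ^ 2 := by
  have hlt : p ^ N < 1 := pow_lt_one₀ hp.1.le hp.2 (by omega)
  have hne : 1 - p ^ N ≠ 0 := by linarith
  have hcast : ∀ k : ℕ, ((k * (k - 1) : ℕ) : ℝ) = (k : ℝ) * (k - 1) := by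
    intro k
    cases k <;> simp
  have h1 := congrArg (Polynomial.eval p) (bernsteinPolynomial.sum_smul ℝ N)
  have h2 := congrArg (Polynomial.eval p) (bernsteinPolynomial.sum_mul_smul ℝ N)
  simp only [Polynomial.eval_finset_sum, nsmul_eq_mul, Polynomial.eval_mul,
    Polynomial.eval_natCast, Polynomial.eval_X, Polynomial.eval_pow, hcast] at h1 h2
  have hb : ∀ k, Polynomial.eval p (bernsteinPolynomial ℝ N k) = q k * (1 - p ^ N) := by
    intro k
    rw [hq, div_mul_cancel₀ _ hne]
    simp [bernsteinPolynomial]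
  have hqN : q N * (1 - p ^ N) = p ^ N := by
    rw [hq, div_mul_cancel₀ _ hne]
    simp
  simp only [hb, ← mul_assoc, ← Finset.sum_mul] at h1 h2
  rw [Finset.sum_range_succ] at h1 h2
  have h3 : ∑ k ∈ Finset.range N, (k : ℝ) * (k - 1) * q k
      = (∑ k ∈ Finset.range N, (k : ℝ) ^ 2 * q k) - ∑ k ∈ Finset.range N, (k : ℝ) * q k := by
    rw [← Finset.sum_sub_distrib]
    exact Finset.sum_congr rfl fun k _ => by ring
  rw [h3] at h2
  have e1 : (∑ k ∈ Finset.range N, (k : ℝ) * q k) = N * (p - p ^ N) / (1 - p ^ N) := by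
    rw [eq_div_iff hne]
    linear_combination h1 - N * hqN
  have e2 : (∑ k ∈ Finset.range N, (k : ℝ) ^ 2 * q k)
      = (N * p * (1 - p) + N ^ 2 * p ^ 2 - N ^ 2 * p ^ N) / (1 - p ^ N) := by
    rw [eq_div_iff hne]
    linear_combination h1 + h2 - N ^ 2 * hqN
  refine ⟨e1, ?_⟩
  rw [e1, e2]
  generalize p ^ N = P at *
  field_simp
  ring
end

section
/- Let X_N be a random variable with moment generating function m(t) = ∏_{j=1}^N ((1 - e^{t b_j})/(1 - e^{t a_j})) · (a_j/b_j), where a_j ≤ b_j are positive integers. Then for every m ≥ 1, the cumulant of order 2m of X_N equals (B_{2m}/(2m)) · Σ_{j=1}^N (b_j^{2m} - a_j^{2m}), where B_{2m} is the 2m-th Bernoulli number, and all cumulants of odd order ≥ 3 vanish. Moreover the first cumulant (the mean) equals (1/2)Σ_{j=1}^N (b_j - a_j). -/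
lemma core_aux (x : ℝ) (hx0 : x ≠ 0) (hx : |x| < 2 * Real.pi) :
    ∃ S : ℝ, HasSum (fun m : ℕ => (((bernoulli (2 * (m + 1)) : ℚ) : ℝ) / (2 * (m + 1)))
        * x ^ (2 * (m + 1)) / Nat.factorial (2 * (m + 1))) S ∧
      Real.exp (x / 2 + S) * x = Real.exp x - 1 := by
  have hpi := Real.pi_pos
  set q : ℝ := (x / (2 * Real.pi)) ^ 2 with hq
  have hq0 : 0 ≤ q := sq_nonneg _
  have hq1 : q < 1 := by
    rw [hq, ← sq_abs, abs_div, abs_of_pos (by positivity : 0 < 2 * Real.pi)]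
    have : |x| / (2 * Real.pi) < 1 := by rw [div_lt_one (by positivity)]; exact hx
    exact pow_lt_one₀ (by positivity) this (by norm_num)
  let f : ℕ × ℕ → ℝ := fun p =>
    (-1) ^ p.1 * q ^ (p.1 + 1) / (p.1 + 1) * (1 / ((p.2 + 1 : ℕ) : ℝ) ^ (2 * (p.1 + 1)))
  have hs2 : Summable (fun n : ℕ => 1 / ((n + 1 : ℕ) : ℝ) ^ 2) :=
    (summable_nat_add_iff (f := fun n : ℕ => 1 / (n : ℝ) ^ 2) 1).2
      (Real.summable_one_div_nat_pow.2 (by norm_num))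
  have hsum : Summable f := by
    have h := (summable_geometric_of_lt_one hq0 hq1).mul_of_nonneg hs2
      (fun k => by positivity) (fun n => by positivity)
    refine Summable.of_norm_bounded h ?_
    rintro ⟨k, n⟩
    simp only [f, norm_mul, norm_div, norm_pow, norm_neg, norm_one, one_pow, one_mul, Real.norm_eq_abs]
    rw [abs_of_nonneg hq0, abs_of_nonneg (by positivity : (0:ℝ) ≤ (k:ℝ) + 1),
      abs_of_nonneg (by positivity : (0:ℝ) ≤ ((n + 1 : ℕ) : ℝ))]
    gcongr
    · calc q ^ (k + 1) / ((k:ℝ) + 1) ≤ q ^ (k + 1) :=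
            div_le_self (by positivity) (by linarith [(Nat.cast_nonneg k : (0:ℝ) ≤ k)])
        _ ≤ q ^ k := pow_le_pow_of_le_one hq0 hq1.le (by omega)
    · push_cast; linarith [(Nat.cast_nonneg n : (0:ℝ) ≤ n)]
    · omega
  have hrow : ∀ k : ℕ, HasSum (fun n => f (k, n))
      ((((bernoulli (2 * (k + 1)) : ℚ) : ℝ) / (2 * (k + 1)))
        * x ^ (2 * (k + 1)) / Nat.factorial (2 * (k + 1))) := by
    intro k
    have h := hasSum_zeta_nat (k := k + 1) (by omega)
    have h1 := (hasSum_nat_add_iff' (f := fun n : ℕ => 1 / (n : ℝ) ^ (2 * (k + 1))) 1).2 h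
    have h2 := h1.mul_left ((-1) ^ k * q ^ (k + 1) / ((k:ℝ) + 1))
    convert! h2 using 1
    have e : 2 * (k + 1) - 1 = 2 * k + 1 := by omega
    have hsg : ((-1 : ℝ)) ^ k * (-1) ^ k = 1 := by rw [← mul_pow]; norm_num
    have hF : ((2 * (k + 1)).factorial : ℝ) ≠ 0 := by positivity
    rw [e, hq, ← pow_mul, div_pow, mul_pow]
    simp only [Finset.sum_range_one, Nat.cast_zero]
    rw [zero_pow (by omega)]
    have h22 : (2:ℝ) ^ (2 * (k + 1)) = 2 ^ (2 * k + 1) * 2 := by rw [← pow_succ]; rfl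
    rw [h22, pow_add (-1 : ℝ) k 2 |> (fun h => (by simpa using h : (-1 : ℝ) ^ (k + 1 + 1) = (-1) ^ k))]
    field_simp
    rw [div_zero, sub_zero]
    linear_combination (-(((bernoulli (2 * (k + 1)) : ℚ) : ℝ) * 2 ^ (2 * k + 1) * Real.pi ^ (2 * (k + 1)))) * hsg
  have hcol : ∀ n : ℕ, HasSum (fun k => f (k, n)) (Real.log (1 + q / ((n:ℝ) + 1) ^ 2)) := by
    intro n
    have hn : (1:ℝ) ≤ ((n:ℝ) + 1) ^ 2 := by
      have : (0:ℝ) ≤ n := Nat.cast_nonneg n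
      nlinarith
    have hy : |-(q / ((n:ℝ) + 1) ^ 2)| < 1 := by
      rw [abs_neg, abs_of_nonneg (by positivity)]
      exact lt_of_le_of_lt (div_le_self hq0 hn) hq1
    have h := (Real.hasSum_pow_div_log_of_abs_lt_one hy).neg
    rw [neg_neg, sub_neg_eq_add] at h
    convert! h using 1
    ext k
    simp only [f]
    rw [neg_pow (q / _), div_pow, ← pow_mul ((n:ℝ) + 1)]
    push_cast
    field_simp
    ring
  have hT := hsum.hasSum
  refine ⟨∑' p, f p, hT.prod_fiberwise hrow, ?_⟩
  have hT' := ((Equiv.prodComm ℕ ℕ).hasSum_iff.2 hT).prod_fiberwise hcol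
  have hlim := hT'.tendsto_sum_nat
  have hlim2 := (Real.continuous_exp.tendsto _).comp hlim
  have heq : (Real.exp ∘ fun n => ∑ i ∈ Finset.range n, Real.log (1 + q / ((i:ℝ) + 1) ^ 2))
      = fun n => ∏ i ∈ Finset.range n, (1 + q / ((i:ℝ) + 1) ^ 2) := by
    ext n
    simp only [Function.comp, Real.exp_sum]
    refine Finset.prod_congr rfl fun i _ => Real.exp_log (by positivity)
  rw [heq] at hlim2
  have hE := Complex.tendsto_euler_sin_prod (Complex.I * (x / (2 * Real.pi) : ℝ))
  have hpc : (Real.pi : ℂ) ≠ 0 := by exact_mod_cast hpi.ne'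
  have hL : Filter.Tendsto (fun n : ℕ => (Complex.I * (((x / 2) * ∏ i ∈ Finset.range n, (1 + q / ((i:ℝ) + 1) ^ 2) : ℝ) : ℂ)))
      Filter.atTop (nhds (Complex.I * ((x / 2 * Real.exp (∑' p, f p) : ℝ) : ℂ))) :=
    ((Complex.continuous_ofReal.tendsto _).comp (hlim2.const_mul (x / 2))).const_mul _
  have hEq := tendsto_nhds_unique hL (by
    convert hE using 2 with n
    · push_cast
      rw [hq]
      have : ∀ j : ℕ, (1 : ℂ) - (Complex.I * ((x:ℂ) / (2 * Real.pi))) ^ 2 / ((j:ℂ) + 1) ^ 2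
          = 1 + (((x / (2 * Real.pi)) ^ 2 : ℝ) : ℂ) / ((j:ℂ) + 1) ^ 2 := by
        intro j
        rw [mul_pow, Complex.I_sq]; push_cast; ring
      simp only [this]
      push_cast
      field_simp)
  have hsin : Complex.sin (Real.pi * (Complex.I * (x / (2 * Real.pi) : ℝ)))
      = Complex.I * ((Real.sinh (x / 2) : ℝ) : ℂ) := by
    have : (Real.pi * (Complex.I * (x / (2 * Real.pi) : ℝ)) : ℂ) = ((x / 2 : ℝ) : ℂ) * Complex.I := by
      push_cast; field_simp
    rw [this, Complex.sin_mul_I, Complex.ofReal_sinh, mul_comm]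
  rw [hsin] at hEq
  have hR := Complex.ofReal_injective (mul_left_cancel₀ Complex.I_ne_zero hEq)
  rw [Real.sinh_eq] at hR
  have h1 : Real.exp x = Real.exp (x / 2) * Real.exp (x / 2) := by rw [← Real.exp_add]; ring_nf
  have h2 : Real.exp (x / 2) * Real.exp (-(x / 2)) = 1 := by rw [← Real.exp_add]; simp
  rw [Real.exp_add, h1]
  linear_combination 2 * Real.exp (x / 2) * hR - h2

/-- Cumulant representation for random variables with moment generating function
`m(t) = ∏_j ((1 - e^{t b_j})/(1 - e^{t a_j})) · (a_j/b_j)`: the cumulant generating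
function `log m(t)` has the expansion `κ₁ t + Σ_{m≥1} κ_{2m} t^{2m}/(2m)!` with
`κ₁ = (1/2)Σ_j (b_j - a_j)` (the mean), `κ_{2m} = (B_{2m}/(2m)) Σ_j (b_j^{2m} - a_j^{2m})`,
and all odd cumulants of order ≥ 3 equal to zero (no odd powers appear). -/
theorem stmt_10 (N : ℕ) (a b : Fin N → ℕ) (ha : ∀ j, 0 < a j) (hab : ∀ j, a j ≤ b j)
    (t : ℝ) (ht : t ≠ 0) (ht2 : ∀ j, |t| * b j < 2 * Real.pi) :
    Real.log (∏ j, ((1 - Real.exp (t * b j)) / (1 - Real.exp (t * a j))) * (a j / b j))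
      = (1 / 2 * ∑ j, ((b j : ℝ) - (a j : ℝ))) * t
        + ∑' m : ℕ,
            (((bernoulli (2 * (m + 1)) : ℚ) : ℝ) / (2 * (m + 1))
                * ∑ j, ((b j : ℝ) ^ (2 * (m + 1)) - (a j : ℝ) ^ (2 * (m + 1))))
              * t ^ (2 * (m + 1)) / Nat.factorial (2 * (m + 1)) := by
  have hb : ∀ j, 0 < b j := fun j => (ha j).trans_le (hab j)
  have ha' : ∀ j, (0:ℝ) < a j := fun j => by exact_mod_cast ha j
  have hb' : ∀ j, (0:ℝ) < b j := fun j => by exact_mod_cast hb j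
  have hab' : ∀ j, (a j : ℝ) ≤ b j := fun j => by exact_mod_cast hab j
  choose SB hSB hEB using fun j => core_aux (t * b j) (mul_ne_zero ht (hb' j).ne')
    (by rw [abs_mul, abs_of_pos (hb' j)]; exact ht2 j)
  choose SA hSA hEA using fun j => core_aux (t * a j) (mul_ne_zero ht (ha' j).ne')
    (by rw [abs_mul, abs_of_pos (ha' j)]
        exact (mul_le_mul_of_nonneg_left (hab' j) (abs_nonneg t)).trans_lt (ht2 j))
  have hsum := hasSum_sum (s := Finset.univ) fun j _ => (hSB j).sub (hSA j)
  have hts : ∑' m : ℕ,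
            (((bernoulli (2 * (m + 1)) : ℚ) : ℝ) / (2 * (m + 1))
                * ∑ j, ((b j : ℝ) ^ (2 * (m + 1)) - (a j : ℝ) ^ (2 * (m + 1))))
              * t ^ (2 * (m + 1)) / Nat.factorial (2 * (m + 1)) = ∑ j, (SB j - SA j) := by
    rw [← hsum.tsum_eq]
    refine tsum_congr fun m => ?_
    rw [Finset.mul_sum, Finset.sum_mul, Finset.sum_div]
    refine Finset.sum_congr rfl fun j _ => ?_
    rw [mul_pow, mul_pow]
    ring
  have hprod : ∏ j, ((1 - Real.exp (t * b j)) / (1 - Real.exp (t * a j))) * ((a j : ℝ) / b j)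
      = Real.exp (∑ j, ((t * b j / 2 + SB j) - (t * a j / 2 + SA j))) := by
    rw [Real.exp_sum]
    refine Finset.prod_congr rfl fun j _ => ?_
    have e1 : 1 - Real.exp (t * b j) = -(Real.exp (t * b j / 2 + SB j) * (t * b j)) := by
      rw [hEB]; ring
    have e2 : 1 - Real.exp (t * a j) = -(Real.exp (t * a j / 2 + SA j) * (t * a j)) := by
      rw [hEA]; ring
    rw [e1, e2, Real.exp_sub]
    have := (ha' j).ne'
    have := (hb' j).ne'
    have := (Real.exp_pos (t * a j / 2 + SA j)).ne'
    generalize Real.exp (t * a j / 2 + SA j) = A at *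
    generalize Real.exp (t * b j / 2 + SB j) = B at *
    field_simp
  rw [hprod, Real.log_exp, hts, Finset.mul_sum, Finset.sum_mul, ← Finset.sum_add_distrib]
  refine Finset.sum_congr rfl fun j _ => ?_
  ring
end
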